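/- arXiv:2508.02983 — 4 statements merged into one kernel-verified Lean document; each statement's English description precedes it below -/
import Mathlib

section
/- Let (A, Δ) be a pre-Lie coalgebra over a field K and let ω ∈ (A⊗A)* be a symmetric solution of the co-S-equation in (A, Δ). Define a product on A by x ∘_ω y := x₍₁₎ ω(x₍₂₎, y) + y₍₁₎ ω(x, y₍₂₎) − ω(x, y₍₁₎) y₍₂₎ (Sweedler notation Δ(x) = x₍₁₎ ⊗ x₍₂₎). Then (A, ∘_ω) is a pre-Lie algebra and (A, ∘_ω, Δ) is a pre-Lie bialgebra. -/
open TensorProduct LinearMap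

noncomputable section

section Defs

variable (K A : Type*) [Field K] [AddCommGroup A] [Module K A]

/-- The flip map on `A ⊗ A`. -/
def flipT : A ⊗[K] A →ₗ[K] A ⊗[K] A := (TensorProduct.comm K A A).toLinearMap

/-- Swap the first two tensor factors of `A ⊗ (A ⊗ A)`. -/
def swap12 : A ⊗[K] (A ⊗[K] A) →ₗ[K] A ⊗[K] (A ⊗[K] A) :=
  (TensorProduct.assoc K A A A).toLinearMap ∘ₗ
    (TensorProduct.map (flipT K A) LinearMap.id) ∘ₗ
      (TensorProduct.assoc K A A A).symm.toLinearMap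

/-- Cyclic permutation `a ⊗ b ⊗ c ↦ c ⊗ a ⊗ b` on `A ⊗ (A ⊗ A)`. -/
def cyc : A ⊗[K] (A ⊗[K] A) →ₗ[K] A ⊗[K] (A ⊗[K] A) :=
  (TensorProduct.comm K (A ⊗[K] A) A).toLinearMap ∘ₗ
    (TensorProduct.assoc K A A A).symm.toLinearMap

variable {K A}

/-- `coassoc1 Δ δ x = x₍₁₎₍₁'₎ ⊗ x₍₁₎₍₂'₎ ⊗ x₍₂₎`, applying `δ` to the first Sweedler leg of `Δ`. -/
def coassoc1 (Δ δ : A →ₗ[K] A ⊗[K] A) : A →ₗ[K] A ⊗[K] (A ⊗[K] A) :=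
  (TensorProduct.assoc K A A A).toLinearMap ∘ₗ (TensorProduct.map δ LinearMap.id) ∘ₗ Δ

/-- `coassoc2 Δ δ x = x₍₁₎ ⊗ x₍₂₎₍₁'₎ ⊗ x₍₂₎₍₂'₎`, applying `δ` to the second Sweedler leg of `Δ`. -/
def coassoc2 (Δ δ : A →ₗ[K] A ⊗[K] A) : A →ₗ[K] A ⊗[K] (A ⊗[K] A) :=
  (TensorProduct.map LinearMap.id δ) ∘ₗ Δ

/-- The (left) pre-Lie identity for a bilinear multiplication. -/
def IsPreLie (m : A →ₗ[K] A →ₗ[K] A) : Prop :=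
  ∀ x y z : A, m (m x y) z - m x (m y z) = m (m y x) z - m y (m x z)

/-- The pre-Lie coalgebra identity for a comultiplication. -/
def IsPreLieCo (Δ : A →ₗ[K] A ⊗[K] A) : Prop :=
  ∀ x : A, coassoc1 Δ Δ x - coassoc2 Δ Δ x
    = swap12 K A (coassoc1 Δ Δ x) - swap12 K A (coassoc2 Δ Δ x)

/-- Equation (2.2) of a pre-Lie bialgebra. -/
def BialgEq1 (m : A →ₗ[K] A →ₗ[K] A) (Δ : A →ₗ[K] A ⊗[K] A) : Prop :=
  ∀ x y : A, Δ (m x y) - Δ (m y x)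
    = rTensor A (m x) (Δ y) + lTensor A (m x) (Δ y) - lTensor A (m.flip x) (Δ y)
      - rTensor A (m y) (Δ x) - lTensor A (m y) (Δ x) + lTensor A (m.flip y) (Δ x)

/-- Equation (2.3) of a pre-Lie bialgebra. -/
def BialgEq2 (m : A →ₗ[K] A →ₗ[K] A) (Δ : A →ₗ[K] A ⊗[K] A) : Prop :=
  ∀ x y : A, Δ (m x y) - flipT K A (Δ (m x y))
    = lTensor A (m.flip y) (Δ x) + lTensor A (m x) (Δ y)
      - flipT K A (rTensor A (m x) (Δ y)) - flipT K A (lTensor A (m.flip y) (Δ x))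
      - flipT K A (lTensor A (m x) (Δ y)) + rTensor A (m x) (Δ y)

/-- `(A, m, Δ)` is a pre-Lie bialgebra. -/
def IsPreLieBialg (m : A →ₗ[K] A →ₗ[K] A) (Δ : A →ₗ[K] A ⊗[K] A) : Prop :=
  IsPreLie m ∧ IsPreLieCo Δ ∧ BialgEq1 m Δ ∧ BialgEq2 m Δ

/-- The linear form on `A ⊗ A` given by `u ⊗ v ↦ f u * g v`. -/
def pairForm (f g : A →ₗ[K] K) : A ⊗[K] A →ₗ[K] K :=
  TensorProduct.lift ((LinearMap.mul K K).compl₁₂ f g)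

/-- The co-S-equation for a bilinear form `ω` on a pre-Lie coalgebra `(A, Δ)`. -/
def IsCoSEq (Δ : A →ₗ[K] A ⊗[K] A) (ω : A →ₗ[K] A →ₗ[K] K) : Prop :=
  ∀ x y z : A,
    pairForm (ω x) (ω.flip z) (Δ y) + pairForm (ω x) (ω y) (Δ z)
      = pairForm (ω.flip y) (ω.flip z) (Δ x) + pairForm (ω y) (ω x) (Δ z)

/-- The multiplication `x ∘_ω y = x₍₁₎ ω(x₍₂₎, y) + y₍₁₎ ω(x, y₍₂₎) − ω(x, y₍₁₎) y₍₂₎`. -/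
def omul (Δ : A →ₗ[K] A ⊗[K] A) (ω : A →ₗ[K] A →ₗ[K] K) : A →ₗ[K] A →ₗ[K] A :=
  TensorProduct.lift ((LinearMap.smulRightₗ ∘ₗ ω).flip) ∘ₗ Δ
  + (TensorProduct.lift ((LinearMap.smulRightₗ ∘ₗ ω.flip).flip) ∘ₗ Δ).flip
  - (TensorProduct.lift (LinearMap.smulRightₗ ∘ₗ ω.flip) ∘ₗ Δ).flip

/-- `N` is a Nijenhuis operator on the (pre-)Lie algebra `(A, m)`. -/
def IsNijenhuis (m : A →ₗ[K] A →ₗ[K] A) (N : A →ₗ[K] A) : Prop :=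
  ∀ x y : A, m (N x) (N y) + N (N (m x y)) = N (m (N x) y) + N (m x (N y))

/-- `S` is a Nijenhuis operator on the (pre-)Lie coalgebra `(A, Δ)`. -/
def IsNijenhuisCo (Δ : A →ₗ[K] A ⊗[K] A) (S : A →ₗ[K] A) : Prop :=
  ∀ x : A, TensorProduct.map S S (Δ x) + Δ (S (S x))
    = rTensor A S (Δ (S x)) + lTensor A S (Δ (S x))

/-- The 2-cocycle (pseudo-Hessian) condition for a bilinear form on a pre-Lie algebra. -/
def IsHessian (m : A →ₗ[K] A →ₗ[K] A) (ω : A →ₗ[K] A →ₗ[K] K) : Prop :=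
  ∀ x y z : A, ω (m x y) z - ω x (m y z) = ω (m y x) z - ω y (m x z)

/-- The multiplication `A ⊗ A →ₗ A` induced by a bilinear multiplication. -/
def mhat (m : A →ₗ[K] A →ₗ[K] A) : A ⊗[K] A →ₗ[K] A := TensorProduct.lift m

variable (K A) in
/-- The middle-four exchange `(a ⊗ b) ⊗ (c ⊗ d) ↦ (a ⊗ c) ⊗ (b ⊗ d)` as a linear map. -/
def ttc : (A ⊗[K] A) ⊗[K] (A ⊗[K] A) →ₗ[K] (A ⊗[K] A) ⊗[K] (A ⊗[K] A) :=
  (TensorProduct.tensorTensorTensorComm K A A A A).toLinearMap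

/-- `(aᵢ ⊗ bᵢ) ⊗ (aⱼ ⊗ bⱼ) ↦ aᵢ ⊗ (bᵢ∘aⱼ) ⊗ bⱼ`. -/
def sTerm1 (m : A →ₗ[K] A →ₗ[K] A) :
    (A ⊗[K] A) ⊗[K] (A ⊗[K] A) →ₗ[K] A ⊗[K] (A ⊗[K] A) :=
  lTensor A (rTensor A (mhat m)) ∘ₗ
    lTensor A (TensorProduct.assoc K A A A).symm.toLinearMap ∘ₗ
      (TensorProduct.assoc K A A (A ⊗[K] A)).toLinearMap

/-- `(aᵢ ⊗ bᵢ) ⊗ (aⱼ ⊗ bⱼ) ↦ aᵢ ⊗ aⱼ ⊗ (bᵢ∘bⱼ)`. -/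
def sTerm2 (m : A →ₗ[K] A →ₗ[K] A) :
    (A ⊗[K] A) ⊗[K] (A ⊗[K] A) →ₗ[K] A ⊗[K] (A ⊗[K] A) :=
  lTensor A (lTensor A (mhat m) ∘ₗ swap12 K A) ∘ₗ
    (TensorProduct.assoc K A A (A ⊗[K] A)).toLinearMap

/-- `(aᵢ ⊗ bᵢ) ⊗ (aⱼ ⊗ bⱼ) ↦ (aᵢ∘aⱼ) ⊗ bᵢ ⊗ bⱼ`. -/
def sTerm3 (m : A →ₗ[K] A →ₗ[K] A) :
    (A ⊗[K] A) ⊗[K] (A ⊗[K] A) →ₗ[K] A ⊗[K] (A ⊗[K] A) :=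
  rTensor (A ⊗[K] A) (mhat m) ∘ₗ ttc K A

/-- `(aᵢ ⊗ bᵢ) ⊗ (aⱼ ⊗ bⱼ) ↦ aᵢ ⊗ aⱼ ⊗ (bⱼ∘bᵢ)`. -/
def sTerm4 (m : A →ₗ[K] A →ₗ[K] A) :
    (A ⊗[K] A) ⊗[K] (A ⊗[K] A) →ₗ[K] A ⊗[K] (A ⊗[K] A) :=
  lTensor A (lTensor A (mhat m ∘ₗ flipT K A)) ∘ₗ
    (TensorProduct.assoc K A A (A ⊗[K] A)).toLinearMap ∘ₗ ttc K A

/-- `r` is a solution of the S-equation in the pre-Lie algebra `(A, m)`. -/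
def IsSEq (m : A →ₗ[K] A →ₗ[K] A) (r : A ⊗[K] A) : Prop :=
  sTerm1 m (r ⊗ₜ[K] r) + sTerm2 m (r ⊗ₜ[K] r)
    = sTerm3 m (r ⊗ₜ[K] r) + sTerm4 m (r ⊗ₜ[K] r)

/-- The comultiplication `Δ_r(x) = x∘aᵢ ⊗ bᵢ + aᵢ ⊗ x∘bᵢ − aᵢ ⊗ bᵢ∘x`. -/
def coprodR (m : A →ₗ[K] A →ₗ[K] A) (r : A ⊗[K] A) : A →ₗ[K] A ⊗[K] A :=
  (rTensorHom (M := A) ∘ₗ m).flip r + (lTensorHom (M := A) ∘ₗ m).flip r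
    - (lTensorHom (M := A) ∘ₗ m.flip).flip r

/-- The Nijenhuis pre-Lie algebra `((A, m), N)` is `S`-admissible. -/
def IsAdmissible (m : A →ₗ[K] A →ₗ[K] A) (N S : A →ₗ[K] A) : Prop :=
  (∀ x y : A, S (m (N x) y) + m x (S (S y)) = m (N x) (S y) + S (m x (S y))) ∧
  (∀ x y : A, S (m x (N y)) + m (S (S x)) y = m (S x) (N y) + S (m (S x) y))

/-- `((A*, Δ*), S*)` is `N*`-admissible, written on `A`. -/
def IsCoAdmissible (Δ : A →ₗ[K] A ⊗[K] A) (N S : A →ₗ[K] A) : Prop :=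
  (∀ x : A, lTensor A S (Δ (N x)) + rTensor A (N ∘ₗ N) (Δ x)
      = TensorProduct.map N S (Δ x) + rTensor A N (Δ (N x))) ∧
  (∀ x : A, rTensor A S (Δ (N x)) + lTensor A (N ∘ₗ N) (Δ x)
      = TensorProduct.map S N (Δ x) + lTensor A N (Δ (N x)))

/-- `(A, m, Δ, N, S)` is a Nijenhuis pre-Lie bialgebra. -/
def IsNijPreLieBialg (m : A →ₗ[K] A →ₗ[K] A) (Δ : A →ₗ[K] A ⊗[K] A)
    (N S : A →ₗ[K] A) : Prop :=
  IsPreLie m ∧ IsNijenhuis m N ∧ IsPreLieCo Δ ∧ IsNijenhuisCo Δ S ∧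
    BialgEq1 m Δ ∧ BialgEq2 m Δ ∧ IsAdmissible m N S ∧ IsCoAdmissible Δ N S

/-- The pre-Lie bialgebra `(A, m, Δ)` is balanced. -/
def IsBalanced (m : A →ₗ[K] A →ₗ[K] A) (Δ : A →ₗ[K] A ⊗[K] A) : Prop :=
  ∀ x y : A, rTensor A (m.flip y) (Δ x) + flipT K A (rTensor A (m.flip x) (Δ y))
    = rTensor A (m.flip x) (Δ y) + flipT K A (rTensor A (m.flip y) (Δ x))

/-- `(A, b)` is a Lie algebra. -/
def IsLieBracket (b : A →ₗ[K] A →ₗ[K] A) : Prop :=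
  (∀ x : A, b x x = 0) ∧
  (∀ x y z : A, b (b x y) z + b (b y z) x + b (b z x) y = 0)

/-- `(A, d)` is a Lie coalgebra. -/
def IsLieCobracket (d : A →ₗ[K] A ⊗[K] A) : Prop :=
  (∀ x : A, d x = - flipT K A (d x)) ∧
  (∀ x : A, coassoc2 d d x + cyc K A (coassoc2 d d x) + cyc K A (cyc K A (coassoc2 d d x)) = 0)

/-- `(A, b, d)` is a Lie bialgebra. -/
def IsLieBialg (b : A →ₗ[K] A →ₗ[K] A) (d : A →ₗ[K] A ⊗[K] A) : Prop :=
  IsLieBracket b ∧ IsLieCobracket d ∧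
    ∀ x y : A, d (b x y)
      = rTensor A (b x) (d y) + lTensor A (b x) (d y)
        - rTensor A (b y) (d x) - lTensor A (b y) (d x)

/-- `(A, b, d, N, S)` is a Nijenhuis Lie bialgebra. -/
def IsNijLieBialg (b : A →ₗ[K] A →ₗ[K] A) (d : A →ₗ[K] A ⊗[K] A)
    (N S : A →ₗ[K] A) : Prop :=
  IsLieBialg b d ∧ IsNijenhuis b N ∧ IsNijenhuisCo d S ∧
  (∀ x y : A, S (b (N x) y) + b x (S (S y)) = b (N x) (S y) + S (b x (S y))) ∧
  (∀ x : A, rTensor A S (d (N x)) + lTensor A (N ∘ₗ N) (d x)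
      = TensorProduct.map S N (d x) + lTensor A N (d (N x)))

/-- The map `r♯ : A* → A`, `r♯(f) = Σ f(aᵢ) bᵢ`. -/
def rsharp (r : A ⊗[K] A) (f : A →ₗ[K] K) : A :=
  TensorProduct.lift (LinearMap.lsmul K A ∘ₗ f) r

/-- The map `N : A → A`, `N(x) = Σ ω(x, aᵢ) bᵢ`. -/
def hessNij (ω : A →ₗ[K] A →ₗ[K] K) (r : A ⊗[K] A) : A →ₗ[K] A :=
  TensorProduct.lift (LinearMap.smulRightₗ ∘ₗ ω.flip) r

/-- The map `S : A → A`, `S(x) = Σ aᵢ ω(bᵢ, x)`. -/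
def coNij (ω : A →ₗ[K] A →ₗ[K] K) (r : A ⊗[K] A) : A →ₗ[K] A :=
  TensorProduct.lift ((LinearMap.smulRightₗ ∘ₗ ω).flip) r

end Defs

section Rep

variable {K A V H : Type*} [Field K] [AddCommGroup A] [Module K A]
  [AddCommGroup V] [Module K V] [AddCommGroup H] [Module K H]

/-- `(V, ρ, φ)` is a representation of the pre-Lie algebra `(A, m)`. -/
def IsRep (m : A →ₗ[K] A →ₗ[K] A) (ρ φ : A →ₗ[K] V →ₗ[K] V) : Prop :=
  (∀ (x y : A) (v : V), ρ (m x y - m y x) v = ρ x (ρ y v) - ρ y (ρ x v)) ∧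
  (∀ (x y : A) (v : V), φ (m x y) v = ρ x (φ y v) - φ y (ρ x v) + φ y (φ x v))

/-- The `α`-conditions making `((V, ρ, φ), α)` a representation of `((A, m), N)`. -/
def IsNijRep (m : A →ₗ[K] A →ₗ[K] A) (N : A →ₗ[K] A) (ρ φ : A →ₗ[K] V →ₗ[K] V)
    (α : V →ₗ[K] V) : Prop :=
  (∀ (x : A) (v : V), ρ (N x) (α v) + α (α (ρ x v)) = α (ρ (N x) v) + α (ρ x (α v))) ∧
  (∀ (x : A) (v : V), φ (N x) (α v) + α (α (φ x v)) = α (φ (N x) v) + α (φ x (α v)))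

/-- The semidirect product multiplication on `A ⊕ V`:
`(x+u) ∘ (y+v) = x∘y + ρ(x)v + φ(y)u`. -/
def semidirectMul (m : A →ₗ[K] A →ₗ[K] A) (ρ φ : A →ₗ[K] V →ₗ[K] V) :
    (A × V) →ₗ[K] (A × V) →ₗ[K] (A × V) :=
  (m.compl₁₂ (fst K A V) (fst K A V)).compr₂ (inl K A V)
  + (ρ.compl₁₂ (fst K A V) (snd K A V)).compr₂ (inr K A V)
  + ((φ.compl₁₂ (fst K A V) (snd K A V)).compr₂ (inr K A V)).flip

/-- The bicrossed product multiplication on `A ⊕ H`: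
`(x+a) ∘ (y+b) = x∘y + ρ_H(a)y + φ_H(b)x + a∘b + ρ_A(x)b + φ_A(y)a`. -/
def matchedMul (mA : A →ₗ[K] A →ₗ[K] A) (mH : H →ₗ[K] H →ₗ[K] H)
    (ρA φA : A →ₗ[K] H →ₗ[K] H) (ρH φH : H →ₗ[K] A →ₗ[K] A) :
    (A × H) →ₗ[K] (A × H) →ₗ[K] (A × H) :=
  (mA.compl₁₂ (fst K A H) (fst K A H)).compr₂ (inl K A H)
  + (ρH.compl₁₂ (snd K A H) (fst K A H)).compr₂ (inl K A H)
  + ((φH.compl₁₂ (snd K A H) (fst K A H)).compr₂ (inl K A H)).flip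
  + (mH.compl₁₂ (snd K A H) (snd K A H)).compr₂ (inr K A H)
  + (ρA.compl₁₂ (fst K A H) (snd K A H)).compr₂ (inr K A H)
  + ((φA.compl₁₂ (fst K A H) (snd K A H)).compr₂ (inr K A H)).flip

/-- Equations (3.5)–(3.8) of a matched pair of pre-Lie algebras. -/
def MatchedPairEqs (mA : A →ₗ[K] A →ₗ[K] A) (mH : H →ₗ[K] H →ₗ[K] H)
    (ρA φA : A →ₗ[K] H →ₗ[K] H) (ρH φH : H →ₗ[K] A →ₗ[K] A) : Prop :=
  (∀ (x : A) (a b : H), ρA x (mH a b)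
      = -(ρA (ρH a x - φH a x) b) + mH (ρA x a - φA x a) b + φA (φH b x) a + mH a (ρA x b)) ∧
  (∀ (x : A) (a b : H), φA x (mH a b - mH b a)
      = φA (ρH b x) a - φA (ρH a x) b + mH a (φA x b) - mH b (φA x a)) ∧
  (∀ (a : H) (x y : A), ρH a (mA x y)
      = -(ρH (ρA x a - φA x a) y) + mA (ρH a x - φH a x) y + φH (φA y a) x + mA x (ρH a y)) ∧
  (∀ (a : H) (x y : A), φH a (mA x y - mA y x)
      = φH (ρA y a) x - φH (ρA x a) y + mA x (φH a y) - mA y (φH a x))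

/-- The (negative) dual action `x ↦ ρ*(x)`, `⟨ρ*(x)v*, v⟩ = −⟨v*, ρ(x)v⟩`. -/
def negTranspose (ρ : A →ₗ[K] V →ₗ[K] V) :
    A →ₗ[K] (V →ₗ[K] K) →ₗ[K] (V →ₗ[K] K) :=
  Module.Dual.transpose (R := K) ∘ₗ (-ρ)

end Rep

set_option synthInstance.maxHeartbeats 1000000
set_option maxHeartbeats 1000000

section Theorems

variable {K A V H : Type*} [Field K] [AddCommGroup A] [Module K A]
  [AddCommGroup V] [Module K V] [AddCommGroup H] [Module K H]

/-- The product on the dual space induced by `Δ`. -/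
def dm (Δ : A →ₗ[K] A ⊗[K] A) (f g : A →ₗ[K] K) : A →ₗ[K] K := pairForm f g ∘ₗ Δ

/-- `f(u) v`. -/
def lc (f : A →ₗ[K] K) : A ⊗[K] A →ₗ[K] A := TensorProduct.lift (LinearMap.lsmul K A ∘ₗ f)

/-- `f(v) u`. -/
def rc (f : A →ₗ[K] K) : A ⊗[K] A →ₗ[K] A := TensorProduct.lift (LinearMap.lsmul K A ∘ₗ f).flip

theorem pairForm_tmul (f g : A →ₗ[K] K) (u v : A) : pairForm f g (u ⊗ₜ[K] v) = f u * g v := by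
  simp [pairForm]

theorem lc_tmul (f : A →ₗ[K] K) (u v : A) : lc f (u ⊗ₜ[K] v) = f u • v := by
  simp [lc]

theorem rc_tmul (f : A →ₗ[K] K) (u v : A) : rc f (u ⊗ₜ[K] v) = f v • u := by
  simp [rc]

theorem apply_lc (f g : A →ₗ[K] K) (t : A ⊗[K] A) : g (lc f t) = pairForm f g t := by
  induction t with
  | zero => simp
  | tmul u v => simp [lc_tmul, pairForm_tmul]
  | add a b ha hb => simp [ha, hb]

theorem apply_rc (f g : A →ₗ[K] K) (t : A ⊗[K] A) : g (rc f t) = pairForm g f t := by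
  induction t with
  | zero => simp
  | tmul u v => simp [rc_tmul, pairForm_tmul, mul_comm]
  | add a b ha hb => simp [ha, hb]

theorem pairForm_rTensor (f g : A →ₗ[K] K) (h : A →ₗ[K] A) (t : A ⊗[K] A) :
    pairForm f g (rTensor A h t) = pairForm (f ∘ₗ h) g t := by
  induction t with
  | zero => simp
  | tmul u v => simp [pairForm_tmul]
  | add a b ha hb => simp [ha, hb]

theorem pairForm_lTensor (f g : A →ₗ[K] K) (h : A →ₗ[K] A) (t : A ⊗[K] A) :
    pairForm f g (lTensor A h t) = pairForm f (g ∘ₗ h) t := by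
  induction t with
  | zero => simp
  | tmul u v => simp [pairForm_tmul]
  | add a b ha hb => simp [ha, hb]

theorem pairForm_flipT (f g : A →ₗ[K] K) (t : A ⊗[K] A) :
    pairForm f g (flipT K A t) = pairForm g f t := by
  induction t with
  | zero => simp
  | tmul u v => simp [pairForm_tmul, flipT, mul_comm]
  | add a b ha hb => simp [ha, hb]

theorem pairForm_sep {s t : A ⊗[K] A} (h : ∀ f g : A →ₗ[K] K, pairForm f g s = pairForm f g t) :
    s = t := by
  let b := Module.Basis.ofVectorSpace K A
  apply (b.tensorProduct b).ext_elem
  rintro ⟨i, j⟩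
  have key : ∀ r : A ⊗[K] A,
      (b.tensorProduct b).repr r (i, j) = pairForm (b.coord i) (b.coord j) r := by
    intro r
    induction r with
    | zero => simp
    | tmul u v => simp [pairForm_tmul, mul_comm]
    | add a c ha hc => simp [ha, hc]
  rw [key, key, h]

theorem dual_sep {u v : A} (h : ∀ f : A →ₗ[K] K, f u = f v) : u = v := by
  rw [← sub_eq_zero, ← Module.forall_dual_apply_eq_zero_iff K]
  intro f
  rw [map_sub, h, sub_self]

theorem pairForm_add_left (f f' g : A →ₗ[K] K) (t : A ⊗[K] A) :
    pairForm (f + f') g t = pairForm f g t + pairForm f' g t := by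
  simp only [← apply_rc, LinearMap.add_apply]

theorem pairForm_sub_left (f f' g : A →ₗ[K] K) (t : A ⊗[K] A) :
    pairForm (f - f') g t = pairForm f g t - pairForm f' g t := by
  simp only [← apply_rc, LinearMap.sub_apply]

theorem pairForm_add_right (f g g' : A →ₗ[K] K) (t : A ⊗[K] A) :
    pairForm f (g + g') t = pairForm f g t + pairForm f g' t := by
  simp only [← apply_lc, LinearMap.add_apply]

theorem pairForm_sub_right (f g g' : A →ₗ[K] K) (t : A ⊗[K] A) :
    pairForm f (g - g') t = pairForm f g t - pairForm f g' t := by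
  simp only [← apply_lc, LinearMap.sub_apply]

/-- The trilinear form `u ⊗ v ⊗ w ↦ f u * (g v * h w)`. -/
def triForm (f g h : A →ₗ[K] K) : A ⊗[K] (A ⊗[K] A) →ₗ[K] K :=
  TensorProduct.lift ((LinearMap.mul K K).compl₁₂ f (pairForm g h))

theorem triForm_tmul (f g h : A →ₗ[K] K) (u : A) (t : A ⊗[K] A) :
    triForm f g h (u ⊗ₜ[K] t) = f u * pairForm g h t := by
  simp [triForm]

theorem triForm_assoc (f g h : A →ₗ[K] K) (t : A ⊗[K] A) (w : A) :
    triForm f g h (TensorProduct.assoc K A A A (t ⊗ₜ[K] w)) = pairForm f g t * h w := by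
  induction t with
  | zero => simp
  | tmul u v => simp [triForm_tmul, pairForm_tmul, mul_assoc]
  | add a b ha hb => simp [ha, hb, TensorProduct.add_tmul, add_mul]

theorem triForm_swap (f g h : A →ₗ[K] K) (t : A ⊗[K] (A ⊗[K] A)) :
    triForm f g h (swap12 K A t) = triForm g f h t := by
  induction t with
  | zero => simp
  | tmul u s =>
    induction s with
    | zero => simp
    | tmul v w => simp [triForm_tmul, pairForm_tmul, swap12, flipT]; ring
    | add a b ha hb => simp [ha, hb, TensorProduct.tmul_add]
  | add a b ha hb => simp [ha, hb]

theorem triForm_coassoc1 (Δ : A →ₗ[K] A ⊗[K] A) (f g h : A →ₗ[K] K) (x : A) :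
    triForm f g h (coassoc1 Δ Δ x) = pairForm (dm Δ f g) h (Δ x) := by
  simp only [coassoc1, LinearMap.comp_apply]
  induction Δ x with
  | zero => simp
  | tmul u v =>
    simp only [TensorProduct.map_tmul, LinearMap.id_apply, LinearEquiv.coe_coe, triForm_assoc,
      pairForm_tmul, dm, LinearMap.comp_apply]
  | add a b ha hb => simp only [map_add, ha, hb]

theorem triForm_coassoc2 (Δ : A →ₗ[K] A ⊗[K] A) (f g h : A →ₗ[K] K) (x : A) :
    triForm f g h (coassoc2 Δ Δ x) = pairForm f (dm Δ g h) (Δ x) := by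
  simp only [coassoc2, LinearMap.comp_apply]
  induction Δ x with
  | zero => simp
  | tmul u v =>
    simp only [TensorProduct.map_tmul, LinearMap.id_apply, triForm_tmul,
      pairForm_tmul, dm, LinearMap.comp_apply]
  | add a b ha hb => simp only [map_add, ha, hb]

theorem dual_preLie {Δ : A →ₗ[K] A ⊗[K] A} (hΔ : IsPreLieCo Δ) (f g h : A →ₗ[K] K) (x : A) :
    pairForm (dm Δ f g) h (Δ x) - pairForm f (dm Δ g h) (Δ x)
      = pairForm (dm Δ g f) h (Δ x) - pairForm g (dm Δ f h) (Δ x) := by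
  have := congrArg (triForm f g h) (hΔ x)
  simpa only [map_sub, triForm_swap, triForm_coassoc1, triForm_coassoc2] using this

theorem omul_eq (Δ : A →ₗ[K] A ⊗[K] A) (ω : A →ₗ[K] A →ₗ[K] K)
    (hsym : ∀ x y : A, ω x y = ω y x) (x y : A) :
    omul Δ ω x y = rc (ω y) (Δ x) + rc (ω x) (Δ y) - lc (ω x) (Δ y) := by
  simp only [omul, LinearMap.sub_apply, LinearMap.add_apply, LinearMap.flip_apply,
    LinearMap.comp_apply]
  refine congrArg₂ _ (congrArg₂ _ ?_ ?_) ?_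
  · induction Δ x with
    | zero => simp
    | tmul u v => simp [rc_tmul, hsym v y]
    | add a b ha hb => simp [ha, hb]
  · induction Δ y with
    | zero => simp
    | tmul u v => simp [rc_tmul]
    | add a b ha hb => simp [ha, hb]
  · induction Δ y with
    | zero => simp
    | tmul u v => simp [lc_tmul]
    | add a b ha hb => simp [ha, hb]

theorem apply_omul (Δ : A →ₗ[K] A ⊗[K] A) (ω : A →ₗ[K] A →ₗ[K] K)
    (hsym : ∀ x y : A, ω x y = ω y x) (f : A →ₗ[K] K) (x y : A) :
    f (omul Δ ω x y)
      = pairForm f (ω y) (Δ x) + pairForm f (ω x) (Δ y) - pairForm (ω x) f (Δ y) := by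
  rw [omul_eq Δ ω hsym, map_sub, map_add, apply_rc, apply_rc, apply_lc]

theorem omega_omul (Δ : A →ₗ[K] A ⊗[K] A) (ω : A →ₗ[K] A →ₗ[K] K)
    (hsym : ∀ x y : A, ω x y = ω y x) (hω : IsCoSEq Δ ω) (x y : A) :
    ω (omul Δ ω x y) = dm Δ (ω x) (ω y) := by
  have hfl : ω.flip = ω := by
    ext a b
    exact hsym b a
  ext z
  rw [hsym, apply_omul Δ ω hsym]
  have := hω x z y
  rw [hfl] at this
  simp only [dm, LinearMap.comp_apply]
  linear_combination -this

theorem comp_omul (Δ : A →ₗ[K] A ⊗[K] A) (ω : A →ₗ[K] A →ₗ[K] K)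
    (hsym : ∀ x y : A, ω x y = ω y x) (f : A →ₗ[K] K) (x : A) :
    f ∘ₗ omul Δ ω x = ω (lc f (Δ x)) + dm Δ f (ω x) - dm Δ (ω x) f := by
  ext v
  simp only [LinearMap.comp_apply, LinearMap.sub_apply, LinearMap.add_apply, dm,
    apply_omul Δ ω hsym]
  rw [hsym _ v, apply_lc]

theorem comp_omul_flip (Δ : A →ₗ[K] A ⊗[K] A) (ω : A →ₗ[K] A →ₗ[K] K)
    (hsym : ∀ x y : A, ω x y = ω y x) (f : A →ₗ[K] K) (x : A) :
    f ∘ₗ (omul Δ ω).flip x = dm Δ f (ω x) + ω (lc f (Δ x)) - ω (rc f (Δ x)) := by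
  ext v
  simp only [LinearMap.comp_apply, LinearMap.sub_apply, LinearMap.add_apply, dm,
    apply_omul Δ ω hsym, LinearMap.flip_apply]
  rw [hsym _ v, apply_lc, hsym _ v, apply_rc]

theorem omul_preLie (Δ : A →ₗ[K] A ⊗[K] A) (ω : A →ₗ[K] A →ₗ[K] K)
    (hΔ : IsPreLieCo Δ) (hsym : ∀ x y : A, ω x y = ω y x) (hω : IsCoSEq Δ ω) :
    IsPreLie (omul Δ ω) := by
  intro x y z
  apply dual_sep (K := K)
  intro f
  have e : ∀ (p q : A →ₗ[K] K) (u v : A), pairForm p q (Δ (omul Δ ω u v))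
      = pairForm (dm Δ p q) (ω v) (Δ u) + pairForm (dm Δ p q) (ω u) (Δ v)
        - pairForm (ω u) (dm Δ p q) (Δ v) :=
    fun p q u v => apply_omul Δ ω hsym (dm Δ p q) u v
  simp only [map_sub, apply_omul Δ ω hsym, omega_omul Δ ω hsym hω, e]
  linear_combination dual_preLie hΔ f (ω y) (ω z) x - dual_preLie hΔ f (ω x) (ω z) y
    - dual_preLie hΔ (ω x) (ω y) f z - dual_preLie hΔ f (ω x) (ω y) z
    + dual_preLie hΔ f (ω y) (ω x) z

theorem cross_l (ω : A →ₗ[K] A →ₗ[K] K) (hsym : ∀ x y : A, ω x y = ω y x)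
    (f : A →ₗ[K] K) (u : A) (t : A ⊗[K] A) : pairForm f (ω u) t = ω (lc f t) u := by
  rw [hsym, apply_lc]

theorem cross_r (ω : A →ₗ[K] A →ₗ[K] K)
    (f : A →ₗ[K] K) (u : A) (t : A ⊗[K] A) : pairForm (ω u) f t = ω u (rc f t) := by
  rw [apply_rc]

theorem omul_eq1 (Δ : A →ₗ[K] A ⊗[K] A) (ω : A →ₗ[K] A →ₗ[K] K)
    (hΔ : IsPreLieCo Δ) (hsym : ∀ x y : A, ω x y = ω y x) :
    BialgEq1 (omul Δ ω) Δ := by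
  intro x y
  apply pairForm_sep
  intro f g
  have e : ∀ (p q : A →ₗ[K] K) (u v : A), pairForm p q (Δ (omul Δ ω u v))
      = pairForm (dm Δ p q) (ω v) (Δ u) + pairForm (dm Δ p q) (ω u) (Δ v)
        - pairForm (ω u) (dm Δ p q) (Δ v) :=
    fun p q u v => apply_omul Δ ω hsym (dm Δ p q) u v
  simp only [map_sub, map_add, e, pairForm_rTensor, pairForm_lTensor, comp_omul Δ ω hsym,
    comp_omul_flip Δ ω hsym, pairForm_add_left, pairForm_sub_left, pairForm_add_right,
    pairForm_sub_right]
  have c1 : pairForm (ω (lc f (Δ x))) g (Δ y) = pairForm f (ω (rc g (Δ y))) (Δ x) := by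
    rw [cross_r, cross_l ω hsym]
  have c2 : pairForm (ω (lc f (Δ y))) g (Δ x) = pairForm f (ω (rc g (Δ x))) (Δ y) := by
    rw [cross_r, cross_l ω hsym]
  linear_combination dual_preLie hΔ f (ω y) g x - dual_preLie hΔ f (ω x) g y - c1 + c2

theorem omul_eq2 (Δ : A →ₗ[K] A ⊗[K] A) (ω : A →ₗ[K] A →ₗ[K] K)
    (hΔ : IsPreLieCo Δ) (hsym : ∀ x y : A, ω x y = ω y x) :
    BialgEq2 (omul Δ ω) Δ := by
  intro x y
  apply pairForm_sep
  intro f g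
  have e : ∀ (p q : A →ₗ[K] K) (u v : A), pairForm p q (Δ (omul Δ ω u v))
      = pairForm (dm Δ p q) (ω v) (Δ u) + pairForm (dm Δ p q) (ω u) (Δ v)
        - pairForm (ω u) (dm Δ p q) (Δ v) :=
    fun p q u v => apply_omul Δ ω hsym (dm Δ p q) u v
  simp only [map_sub, map_add, e, pairForm_rTensor, pairForm_lTensor, pairForm_flipT,
    comp_omul Δ ω hsym,
    comp_omul_flip Δ ω hsym, pairForm_add_left, pairForm_sub_left, pairForm_add_right,
    pairForm_sub_right]
  simp only [cross_r, cross_l ω hsym]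
  have P1 := dual_preLie hΔ f g (ω y) x
  have P2 := dual_preLie hΔ f g (ω x) y
  have P3 := dual_preLie hΔ f (ω x) g y
  have P4 := dual_preLie hΔ g (ω x) f y
  simp only [cross_r, cross_l ω hsym] at P1 P2 P3 P4
  have s1 := hsym (lc f (Δ x)) (lc g (Δ y))
  have s2 := hsym (lc g (Δ x)) (lc f (Δ y))
  linear_combination P1 + P2 - P3 + P4 - s1 + s2

theorem dual_quasitriangular_preLie_bialgebra
    (Δ : A →ₗ[K] A ⊗[K] A) (ω : A →ₗ[K] A →ₗ[K] K)
    (hΔ : IsPreLieCo Δ) (hsym : ∀ x y : A, ω x y = ω y x) (hω : IsCoSEq Δ ω) :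
    IsPreLie (omul Δ ω) ∧ IsPreLieBialg (omul Δ ω) Δ := by
  have h := omul_preLie Δ ω hΔ hsym hω
  exact ⟨h, h, hΔ, omul_eq1 Δ ω hΔ hsym, omul_eq2 Δ ω hΔ hsym⟩

end Theorems
end
end

section
/- Let (A, ∘) be a pre-Lie algebra over a field K, let r = Σᵢ aᵢ⊗bᵢ ∈ A⊗A be symmetric (τ(r) = r where τ is the flip of A⊗A), and let Δ_r : A → A⊗A be defined by Δ_r(x) = Σᵢ (x∘aᵢ⊗bᵢ + aᵢ⊗x∘bᵢ − aᵢ⊗bᵢ∘x). Then r is a solution of the S-equation in (A, ∘) if and only if (Δ_r⊗id)(r) = Σᵢ,ⱼ aᵢ ⊗ aⱼ ⊗ bᵢ∘bⱼ. -/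
open TensorProduct LinearMap

noncomputable section

set_option synthInstance.maxHeartbeats 1000000
set_option maxHeartbeats 1000000

section Theorems

variable {K A V H : Type*} [Field K] [AddCommGroup A] [Module K A]
  [AddCommGroup V] [Module K V] [AddCommGroup H] [Module K H]

def sig23 (K A : Type*) [Field K] [AddCommGroup A] [Module K A] :
    A ⊗[K] (A ⊗[K] A) →ₗ[K] A ⊗[K] (A ⊗[K] A) := lTensor A (flipT K A)

theorem sig23_sig23 (t : A ⊗[K] (A ⊗[K] A)) : sig23 K A (sig23 K A t) = t := by
  have h : sig23 K A ∘ₗ sig23 K A = LinearMap.id := by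
    ext a b c
    simp [sig23, flipT]
  exact LinearMap.congr_fun h t

theorem sig23_sTerm1 (m : A →ₗ[K] A →ₗ[K] A) (r s : A ⊗[K] A) :
    sig23 K A (sTerm1 m (r ⊗ₜ[K] s)) = sTerm2 m (r ⊗ₜ[K] flipT K A s) := by
  induction r with
  | zero => simp
  | add x y hx hy => simp only [TensorProduct.add_tmul, map_add, hx, hy]
  | tmul a b =>
    induction s with
    | zero => simp
    | add x y hx hy => simp only [TensorProduct.tmul_add, map_add, hx, hy]
    | tmul c d => simp [sig23, flipT, sTerm1, sTerm2, swap12, mhat]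

theorem sig23_sTerm3 (m : A →ₗ[K] A →ₗ[K] A) (r s : A ⊗[K] A) :
    sig23 K A (sTerm3 m (r ⊗ₜ[K] s)) =
      (TensorProduct.assoc K A A A)
        (rTensor A ((rTensorHom (M := A) ∘ₗ m).flip s) r) := by
  induction r with
  | zero => simp
  | add x y hx hy => simp only [TensorProduct.add_tmul, map_add, hx, hy]
  | tmul a b =>
    induction s with
    | zero => simp
    | add x y hx hy =>
      simp only [TensorProduct.tmul_add, map_add, hx, hy, rTensor_add, LinearMap.add_apply]
    | tmul c d => simp [sig23, flipT, sTerm3, ttc, mhat]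

theorem sig23_sTerm4 (m : A →ₗ[K] A →ₗ[K] A) (r s : A ⊗[K] A) :
    sig23 K A (sTerm4 m (r ⊗ₜ[K] s)) =
      (TensorProduct.assoc K A A A)
        (rTensor A ((lTensorHom (M := A) ∘ₗ m).flip r) (flipT K A s)) := by
  induction r with
  | zero => simp
  | add x y hx hy =>
    simp only [TensorProduct.add_tmul, map_add, hx, hy, rTensor_add, LinearMap.add_apply]
  | tmul a b =>
    induction s with
    | zero => simp
    | add x y hx hy => simp only [TensorProduct.tmul_add, map_add, hx, hy]
    | tmul c d => simp [sig23, flipT, sTerm4, ttc, mhat]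

theorem sTerm1_eq_assoc (m : A →ₗ[K] A →ₗ[K] A) (r s : A ⊗[K] A) :
    sTerm1 m (r ⊗ₜ[K] s) =
      (TensorProduct.assoc K A A A)
        (rTensor A ((lTensorHom (M := A) ∘ₗ m.flip).flip r) s) := by
  induction r with
  | zero => simp
  | add x y hx hy =>
    simp only [TensorProduct.add_tmul, map_add, hx, hy, rTensor_add, LinearMap.add_apply]
  | tmul a b =>
    induction s with
    | zero => simp
    | add x y hx hy => simp only [TensorProduct.tmul_add, map_add, hx, hy]
    | tmul c d => simp [sTerm1, mhat]

theorem sEquation_iff_coprod_tensor_id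
    (m : A →ₗ[K] A →ₗ[K] A) (hm : IsPreLie m) (r : A ⊗[K] A)
    (hr : flipT K A r = r) :
    IsSEq m r ↔
      (TensorProduct.assoc K A A A) (rTensor A (coprodR m r) r) = sTerm2 m (r ⊗ₜ[K] r) := by
  have h1 := sig23_sTerm1 m r r
  have h3 := sig23_sTerm3 m r r
  have h4 := sig23_sTerm4 m r r
  have h5 := sTerm1_eq_assoc m r r
  rw [hr] at h1 h4
  have h2 : sig23 K A (sTerm2 m (r ⊗ₜ[K] r)) = sTerm1 m (r ⊗ₜ[K] r) := by
    rw [← h1, sig23_sig23]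
  have hΔ : (TensorProduct.assoc K A A A) (rTensor A (coprodR m r) r) =
      sig23 K A (sTerm3 m (r ⊗ₜ[K] r)) + sig23 K A (sTerm4 m (r ⊗ₜ[K] r))
        - sTerm1 m (r ⊗ₜ[K] r) := by
    rw [h3, h4, h5, coprodR, rTensor_sub, rTensor_add, LinearMap.sub_apply,
      LinearMap.add_apply, map_sub, map_add]
  have hinj : Function.Injective (sig23 K A) :=
    Function.LeftInverse.injective (g := sig23 K A) sig23_sig23
  rw [hΔ, sub_eq_iff_eq_add, IsSEq, ← hinj.eq_iff, map_add, map_add, h1, h2]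
  exact eq_comm

end Theorems
end
end

section
/- Let (A, Δ) be a pre-Lie coalgebra over a field K, let ω ∈ (A⊗A)* be a symmetric bilinear form (ω(x, y) = ω(y, x)), and define x ∘_ω y := x₍₁₎ ω(x₍₂₎, y) + y₍₁₎ ω(x, y₍₂₎) − ω(x, y₍₁₎) y₍₂₎. Then ω is a solution of the co-S-equation in (A, Δ) if and only if ω(x ∘_ω y, z) = ω(x, z₍₁₎) ω(y, z₍₂₎) for all x, y, z ∈ A. -/
open TensorProduct LinearMap

noncomputable section

set_option synthInstance.maxHeartbeats 1000000
set_option maxHeartbeats 1000000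

section Theorems

variable {K A V H : Type*} [Field K] [AddCommGroup A] [Module K A]
  [AddCommGroup V] [Module K V] [AddCommGroup H] [Module K H]

theorem omul_form
    (Δ : A →ₗ[K] A ⊗[K] A) (ω : A →ₗ[K] A →ₗ[K] K)
    (hsym : ∀ x y : A, ω x y = ω y x) (x y z : A) :
    ω (omul Δ ω x y) z = pairForm (ω z) (ω y) (Δ x) + pairForm (ω z) (ω x) (Δ y)
      - pairForm (ω x) (ω z) (Δ y) := by
  have h1 : ∀ t : A ⊗[K] A,
      ω (TensorProduct.lift ((LinearMap.smulRightₗ ∘ₗ ω).flip) t y) z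
        = pairForm (ω z) (ω y) t := by
    intro t
    induction t with
    | zero => simp
    | add a b ha hb => simp only [map_add, LinearMap.add_apply, ha, hb]
    | tmul a b => simp [pairForm, hsym b y, hsym a z, mul_comm]
  have h2 : ∀ t : A ⊗[K] A,
      ω (TensorProduct.lift ((LinearMap.smulRightₗ ∘ₗ ω.flip).flip) t x) z
        = pairForm (ω z) (ω x) t := by
    intro t
    induction t with
    | zero => simp
    | add a b ha hb => simp only [map_add, LinearMap.add_apply, ha, hb]
    | tmul a b => simp [pairForm, hsym a z, mul_comm]
  have h3 : ∀ t : A ⊗[K] A,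
      ω (TensorProduct.lift (LinearMap.smulRightₗ ∘ₗ ω.flip) t x) z
        = pairForm (ω x) (ω z) t := by
    intro t
    induction t with
    | zero => simp
    | add a b ha hb => simp only [map_add, LinearMap.add_apply, ha, hb]
    | tmul a b => simp [pairForm, hsym b z]
  rw [← h1, ← h2, ← h3]
  simp [omul]

theorem coSEquation_iff_omul_right
    (Δ : A →ₗ[K] A ⊗[K] A) (hΔ : IsPreLieCo Δ) (ω : A →ₗ[K] A →ₗ[K] K)
    (hsym : ∀ x y : A, ω x y = ω y x) :
    IsCoSEq Δ ω ↔
      ∀ x y z : A, ω (omul Δ ω x y) z = pairForm (ω x) (ω y) (Δ z) := by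
  have hflip : ω.flip = ω := by
    ext a b
    exact hsym b a
  unfold IsCoSEq
  rw [hflip]
  constructor
  · intro h x y z
    rw [omul_form Δ ω hsym]
    linear_combination -(h x z y)
  · intro h x y z
    have := h x z y
    rw [omul_form Δ ω hsym] at this
    linear_combination -this

end Theorems
end
end

section
/- Let (A, Δ) and (A, δ) be pre-Lie coalgebras over a field K (Sweedler Δ(x) = x₍₁₎⊗x₍₂₎ and δ(x) = x₍[1]₎⊗x₍[2]₎). Then for all s, t ∈ K the map Δ_{s,t} := sΔ + tδ gives a pre-Lie coalgebra structure on A (i.e., (A, Δ) and (A, δ) are linearly compatible) if and only if, for all x ∈ A: x₍₁₎[1]⊗x₍₁₎[2]⊗x₍₂₎ + x[1]₍₁₎⊗x[1]₍₂₎⊗x[2] − x₍₁₎⊗x₍₂₎[1]⊗x₍₂₎[2] − x[1]⊗x[2]₍₁₎⊗x[2]₍₂₎ = x₍₁₎[2]⊗x₍₁₎[1]⊗x₍₂₎ + x[1]₍₂₎⊗x[1]₍₁₎⊗x[2] − x₍₂₎[1]⊗x₍₁₎⊗x₍₂₎[2] − x[2]₍₁₎⊗x[1]⊗x[2]₍₂₎.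 -/
open TensorProduct LinearMap

noncomputable section

set_option synthInstance.maxHeartbeats 1000000
set_option maxHeartbeats 1000000

section Theorems

variable {K A V H : Type*} [Field K] [AddCommGroup A] [Module K A]
  [AddCommGroup V] [Module K V] [AddCommGroup H] [Module K H]

theorem coassoc1_comb (Δ δ : A →ₗ[K] A ⊗[K] A) (s t : K) (x : A) :
    coassoc1 (s • Δ + t • δ) (s • Δ + t • δ) x
      = (s * s) • coassoc1 Δ Δ x + (s * t) • (coassoc1 Δ δ x + coassoc1 δ Δ x)
        + (t * t) • coassoc1 δ δ x := by
  simp only [coassoc1, TensorProduct.map_add_left, TensorProduct.map_smul_left,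
    LinearMap.comp_apply, LinearMap.add_apply, LinearMap.smul_apply, map_add, map_smul]
  module

theorem coassoc2_comb (Δ δ : A →ₗ[K] A ⊗[K] A) (s t : K) (x : A) :
    coassoc2 (s • Δ + t • δ) (s • Δ + t • δ) x
      = (s * s) • coassoc2 Δ Δ x + (s * t) • (coassoc2 Δ δ x + coassoc2 δ Δ x)
        + (t * t) • coassoc2 δ δ x := by
  simp only [coassoc2, TensorProduct.map_add_right, TensorProduct.map_smul_right,
    LinearMap.comp_apply, LinearMap.add_apply, LinearMap.smul_apply, map_add, map_smul]
  module

theorem linearly_compatible_preLie_coalgebras_iff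
    (Δ δ : A →ₗ[K] A ⊗[K] A) (hΔ : IsPreLieCo Δ) (hδ : IsPreLieCo δ) :
    (∀ s t : K, IsPreLieCo (s • Δ + t • δ)) ↔
      (∀ x : A,
        coassoc1 Δ δ x + coassoc1 δ Δ x - coassoc2 Δ δ x - coassoc2 δ Δ x
          = swap12 K A (coassoc1 Δ δ x) + swap12 K A (coassoc1 δ Δ x)
            - swap12 K A (coassoc2 Δ δ x) - swap12 K A (coassoc2 δ Δ x)) := by
  constructor
  · intro h x
    have h1 := h 1 1 x
    have hA := hΔ x
    have hB := hδ x
    rw [coassoc1_comb, coassoc2_comb] at h1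
    simp only [map_add, map_smul, mul_one, one_smul] at h1
    rw [← sub_eq_zero] at h1 hA hB ⊢
    have e := congrArg₂ (· - ·) h1 (congrArg₂ (· + ·) hA hB)
    simp only [add_zero, sub_zero] at e
    rw [← e]
    abel
  · intro h s t x
    have h1 := h x
    have hA := hΔ x
    have hB := hδ x
    rw [coassoc1_comb, coassoc2_comb]
    simp only [map_add, map_smul]
    linear_combination (norm := module) (s * s) • hA + (s * t) • h1 + (t * t) • hB

end Theorems
end
end
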